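/- Let X ⊆ ℝⁿ be a closed convex set. Then the set L(ℝⁿ, ℝᵐ) \ int({T ∈ L(ℝⁿ, ℝᵐ) : T(X) is closed}) is σ-porous in L(ℝⁿ, ℝᵐ). In particular, int({T ∈ L(ℝⁿ, ℝᵐ) : T(X) is closed}) is open and dense in L(ℝⁿ, ℝᵐ). -/

import Mathlib

open Metric Filter Set

/-- γ(x,R,X): sup of radii r ≥ 0 of open balls contained in B_R(x) \ X (sup ∅ = 0). -/
noncomputable def porGamma {E : Type*} [SeminormedAddCommGroup E] (x : E) (R : ℝ) (X : Set E) : ℝ :=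
  sSup {r : ℝ | 0 ≤ r ∧ ∃ x' : E, ball x' r ⊆ ball x R \ X}

/-- Porosity of X at x: liminf_{R→0⁺} γ(x,R,X)/R. -/
noncomputable def porosityAt {E : Type*} [SeminormedAddCommGroup E] (x : E) (X : Set E) : ℝ :=
  liminf (fun R => porGamma x R X / R) (nhdsWithin 0 (Ioi 0))

/-- X is porous if its porosity is positive at each of its points. -/
def IsPorous {E : Type*} [SeminormedAddCommGroup E] (X : Set E) : Prop :=
  ∀ x ∈ X, 0 < porosityAt x X

/-- X is σ-porous if it is a countable union of porous sets. -/
def IsSigmaPorous {E : Type*} [SeminormedAddCommGroup E] (X : Set E) : Prop :=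
  ∃ f : ℕ → Set E, (∀ k, IsPorous (f k)) ∧ X = ⋃ k, f k

/-- Asymptotic cone of X. -/
def asympCone {E : Type*} [SeminormedAddCommGroup E] [NormedSpace ℝ E] (X : Set E) : Set E :=
  {v | ∃ (x : ℕ → E) (t : ℕ → ℝ), (∀ k, x k ∈ X) ∧ (∀ k, 0 < t k) ∧
    Tendsto (fun k => ‖x k‖) atTop atTop ∧ Tendsto (fun k => t k • x k) atTop (nhds v)}

open Topology

section Porosity

variable {G : Type*} [NormedAddCommGroup G] [NormedSpace ℝ G]

omit [NormedSpace ℝ G] in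
theorem porGamma_nonneg (x : G) (R : ℝ) (S : Set G) : 0 ≤ porGamma x R S :=
  Real.sSup_nonneg fun _ hr => hr.1

theorem le_of_ball_subset_ball_diff [Nontrivial G] {S : Set G} {x : G} {R : ℝ} (hR : 0 ≤ R) :
    ∀ r ∈ {r : ℝ | 0 ≤ r ∧ ∃ x' : G, ball x' r ⊆ ball x R \ S}, r ≤ R := by
  rintro r ⟨hr, y, hy⟩
  have := diam_mono (hy.trans sdiff_subset) isBounded_ball
  rw [diam_ball_eq y hr, diam_ball_eq x hR] at this
  linarith

theorem isCoboundedUnder_porGamma_div [Nontrivial G] (x : G) (S : Set G) :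
    IsCoboundedUnder (· ≥ ·) (𝓝[>] 0) fun R => porGamma x R S / R := by
  refine isCoboundedUnder_ge_of_eventually_le (x := 1) _ ?_
  filter_upwards [self_mem_nhdsWithin] with R (hR : 0 < R)
  rw [div_le_one hR]
  exact Real.sSup_le (le_of_ball_subset_ball_diff hR.le) hR.le

/-- A linear supply of holes at `x` gives positive porosity at `x`. -/
theorem porosityAt_pos {S : Set G} {x : G} (hx : x ∈ S) {c C ε₀ : ℝ} (hc : 0 < c) (hC : 0 ≤ C)
    (hε₀ : 0 < ε₀)
    (h : ∀ ε, 0 < ε → ε < ε₀ → ∃ y, dist y x ≤ C * ε ∧ Disjoint (ball y (c * ε)) S) :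
    0 < porosityAt x S := by
  have hnt : Nontrivial G := by
    obtain ⟨y, -, hy⟩ := h (ε₀ / 2) (by linarith) (by linarith)
    refine ⟨y, x, ?_⟩
    rintro rfl
    exact hy.le_bot ⟨mem_ball_self (by positivity), hx⟩
  have hcC : 0 < c + C := by positivity
  refine (div_pos hc hcC).trans_le (le_liminf_of_le (isCoboundedUnder_porGamma_div x S) ?_)
  have hsmall : Ioo 0 ((c + C) * ε₀) ∈ 𝓝[>] (0 : ℝ) := Ioo_mem_nhdsGT (by positivity)
  filter_upwards [hsmall] with R hR
  obtain ⟨hR0, hR1⟩ := hR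
  obtain ⟨y, hyx, hy⟩ := h (R / (c + C)) (by positivity) (by rwa [div_lt_iff₀' hcC])
  rw [le_div_iff₀ hR0]
  refine le_csSup ⟨R, le_of_ball_subset_ball_diff hR0.le⟩ ⟨by positivity, y, ?_⟩
  have hsum : c * (R / (c + C)) + C * (R / (c + C)) = R := by field_simp
  rw [show c / (c + C) * R = c * (R / (c + C)) by ring]
  intro z hz
  refine ⟨?_, fun hzS => hy.le_bot ⟨hz, hzS⟩⟩
  rw [mem_ball] at hz ⊢
  linarith [dist_triangle z y x]

theorem porosityAt_mono {S S' : Set G} (hSS' : S ⊆ S') {x : G} (hx : x ∈ S)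
    (h : 0 < porosityAt x S') : 0 < porosityAt x S := by
  rcases subsingleton_or_nontrivial G with hG | hG
  · have : S = S' := hSS'.antisymm fun y _ => Subsingleton.elim x y ▸ hx
    rwa [this]
  refine h.trans_le (liminf_le_liminf ?_ ?_ (isCoboundedUnder_porGamma_div x S))
  · filter_upwards [self_mem_nhdsWithin] with R (hR : 0 < R)
    gcongr
    refine csSup_le_csSup ⟨R, le_of_ball_subset_ball_diff hR.le⟩ ⟨0, le_rfl, x, by simp⟩ ?_
    rintro r ⟨hr, x', hx'⟩
    exact ⟨hr, x', hx'.trans (by gcongr)⟩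
  · refine isBoundedUnder_of_eventually_ge (a := 0) ?_
    filter_upwards [self_mem_nhdsWithin] with R (hR : 0 < R)
    exact div_nonneg (porGamma_nonneg _ _ _) hR.le

theorem IsPorous.mono {S S' : Set G} (h : IsPorous S') (hSS' : S ⊆ S') : IsPorous S :=
  fun x hx => porosityAt_mono hSS' hx (h x (hSS' hx))

omit [NormedSpace ℝ G] in
theorem IsPorous.interior_eq_empty {S : Set G} (h : IsPorous S) : interior S = ∅ := by
  rw [eq_empty_iff_forall_notMem]
  intro x hx
  obtain ⟨R₀, hR₀, hball⟩ := Metric.isOpen_iff.1 isOpen_interior x hx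
  have hzero : porosityAt x S = 0 := by
    refine (liminf_congr ?_).trans (liminf_const (0 : ℝ))
    filter_upwards [Ioo_mem_nhdsGT hR₀] with R hR
    have hsub : {r : ℝ | 0 ≤ r ∧ ∃ x' : G, ball x' r ⊆ ball x R \ S} ⊆ {0} := by
      rintro r ⟨hr, x', hx'⟩
      by_contra hne
      have hmem := hx' (mem_ball_self (hr.lt_of_ne (Ne.symm hne)))
      exact hmem.2 (interior_subset (hball (ball_subset_ball hR.2.le hmem.1)))
    have : porGamma x R S = 0 :=
      le_antisymm (Real.sSup_le (fun r hr => (hsub hr).le) le_rfl) (porGamma_nonneg _ _ _)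
    rw [this, zero_div]
  exact (h x (interior_subset hx)).ne' hzero

theorem IsPorous.isSigmaPorous_of_subset_union {B N S : Set G} (hN : IsPorous N) (hS : IsPorous S)
    (hB : B ⊆ N ∪ S) : IsSigmaPorous B := by
  refine ⟨fun k => if k = 0 then B ∩ N else B ∩ S, fun k => ?_, ?_⟩
  · dsimp only
    split_ifs
    · exact hN.mono inter_subset_right
    · exact hS.mono inter_subset_right
  · refine Subset.antisymm (fun x hx => ?_) (iUnion_subset fun k => ?_)
    · rcases hB hx with h | h
      · exact mem_iUnion.2 ⟨0, by simpa using ⟨hx, h⟩⟩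
      · exact mem_iUnion.2 ⟨1, by simpa using ⟨hx, h⟩⟩
    · split_ifs <;> exact inter_subset_left

end Porosity

section LinearMaps

variable {E F : Type*} [NormedAddCommGroup E] [NormedSpace ℝ E] [FiniteDimensional ℝ E]
  [NormedAddCommGroup F] [NormedSpace ℝ F] [FiniteDimensional ℝ F]

/-- A linear map whose domain is no larger than its codomain becomes injective after adding a
map, at a rate linear in the coefficient. -/
theorem LinearMap.exists_add_smul_lower_bound {V : Type*} [NormedAddCommGroup V] [NormedSpace ℝ V]
    [FiniteDimensional ℝ V] (hd : Module.finrank ℝ V ≤ Module.finrank ℝ F) (B : V →ₗ[ℝ] F) :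
    ∃ A : V →ₗ[ℝ] F, ∃ c : ℝ, 0 < c ∧
      ∀ ε, 0 < ε → ε < 1 → ∀ x, c * ε * ‖x‖ ≤ ‖B x + ε • A x‖ := by
  obtain ⟨D, hD⟩ := (LinearMap.range B).exists_isCompl
  have hrank : Module.finrank ℝ (LinearMap.ker B) ≤ Module.finrank ℝ D := by
    have h1 := LinearMap.finrank_range_add_finrank_ker B
    have h2 := Submodule.finrank_add_eq_of_isCompl hD
    omega
  obtain ⟨j, hj⟩ : ∃ j : LinearMap.ker B →ₗ[ℝ] D, Function.Injective j := by
    refine Module.Free.exists_linearMap_injective_of_linearIndependent_of_lift_rank_le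
      (Module.finBasis ℝ D).linearIndependent ?_
    rw [← Module.finrank_eq_rank]
    simpa only [Cardinal.lift_natCast, Cardinal.mk_fin, Nat.cast_le] using hrank
  obtain ⟨P, hP⟩ := (LinearMap.ker B).subtype.exists_leftInverse_of_injective
    (LinearMap.ker_eq_bot.2 Subtype.val_injective)
  have hPk : ∀ y : LinearMap.ker B, P y = y := fun y => LinearMap.congr_fun hP y
  set A : V →ₗ[ℝ] F := D.subtype ∘ₗ j ∘ₗ P with hA
  have hinj : Function.Injective (B + A) := by
    rw [← LinearMap.ker_eq_bot, LinearMap.ker_eq_bot']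
    intro x hx
    have hAD : A x ∈ D := (j (P x)).2
    have hAB : A x ∈ LinearMap.range B :=
      ⟨-x, by rw [map_neg]; exact (eq_neg_of_add_eq_zero_right hx).symm⟩
    have hA0 : A x = 0 := (Submodule.disjoint_def.1 hD.disjoint) _ hAB hAD
    have hB0 : B x = 0 := by simpa [hA0] using hx
    have hPx : P x = 0 := hj (by simpa [hA] using hA0)
    simpa [hPx] using (congrArg Subtype.val (hPk ⟨x, hB0⟩)).symm
  obtain ⟨κ, hκ, hanti⟩ := (B + A).exists_antilipschitzWith (LinearMap.ker_eq_bot.2 hinj)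
  let Q : V →L[ℝ] V := LinearMap.toContinuousLinearMap ((LinearMap.ker B).subtype ∘ₗ P)
  have hQB : ∀ x, B (Q x) = 0 := fun x => (P x).2
  have hQQ : ∀ x, Q (Q x) = Q x := fun x => congrArg Subtype.val (hPk (P x))
  have hQA : ∀ x, A (Q x) = A x := fun x => congrArg (fun y => (j y : F)) (hPk (P x))
  have hκ' : (0 : ℝ) < κ := hκ
  set q : ℝ := 2 * ‖Q‖ + 1 with hq
  have hq0 : 0 < q := by positivity
  refine ⟨A, (κ * q)⁻¹, by positivity, fun ε hε hε1 x => ?_⟩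
  set y := x - Q x + ε • Q x with hy
  have hMy : (B + A) y = B x + ε • A x := by
    simp [hy, hQB, hQA]
  have h1 : ‖y‖ ≤ κ * ‖B x + ε • A x‖ := by
    simpa [hMy] using hanti.le_mul_dist y 0
  have h2 : ε • x = Q y + ε • (y - Q y) := by
    simp only [hy, map_add, map_sub, map_smul, hQQ]
    module
  have h3 : ε * ‖x‖ ≤ q * ‖y‖ := by
    have e1 : ‖ε • x‖ ≤ ‖Q y‖ + ‖ε • (y - Q y)‖ := h2 ▸ norm_add_le _ _
    rw [norm_smul, norm_smul, Real.norm_of_nonneg hε.le] at e1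
    have e2 := norm_sub_le y (Q y)
    have e3 := Q.le_opNorm y
    have e4 : ε * ‖y - Q y‖ ≤ 1 * ‖y - Q y‖ := by gcongr
    rw [hq]
    linarith
  rw [mul_assoc, inv_mul_le_iff₀ (by positivity)]
  calc ε * ‖x‖ ≤ q * ‖y‖ := h3
    _ ≤ q * (κ * ‖B x + ε • A x‖) := by gcongr
    _ = κ * q * ‖B x + ε • A x‖ := by ring

theorem isPorous_setOf_not_injective_on {V : Submodule ℝ E}
    (hd : Module.finrank ℝ V ≤ Module.finrank ℝ F) :
    IsPorous {T : E →L[ℝ] F | ¬ Function.Injective (T.comp V.subtypeL)} := by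
  intro T hT
  obtain ⟨A, c, hc, hA⟩ := LinearMap.exists_add_smul_lower_bound hd (T.comp V.subtypeL).toLinearMap
  obtain ⟨π, hπ⟩ := V.subtype.exists_leftInverse_of_injective
    (LinearMap.ker_eq_bot.2 Subtype.val_injective)
  let L : E →L[ℝ] F := LinearMap.toContinuousLinearMap (A ∘ₗ π)
  have hL : ∀ x : V, L x = A x := fun x => congrArg A (LinearMap.congr_fun hπ x)
  refine porosityAt_pos hT hc (norm_nonneg L) one_pos fun ε hε hε1 => ⟨T + ε • L, ?_, ?_⟩
  · rw [dist_eq_norm, add_sub_cancel_left, norm_smul, Real.norm_of_nonneg hε.le, mul_comm]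
  · rw [Set.disjoint_left]
    intro T' hT' hninj
    refine hninj ((injective_iff_map_eq_zero _).2 fun x hx => ?_)
    by_contra hx0
    have hxpos : 0 < ‖x‖ := norm_pos_iff.2 hx0
    have hTx : T' x = 0 := hx
    have h1 : c * ε * ‖x‖ ≤ ‖(T + ε • L) x‖ := by
      simpa [hL] using hA ε hε hε1 x
    have h2 : ‖(T' - (T + ε • L)) x‖ ≤ ‖T' - (T + ε • L)‖ * ‖x‖ :=
      (T' - (T + ε • L)).le_opNorm (x : E)
    rw [sub_apply, hTx, zero_sub, norm_neg] at h2
    rw [mem_ball, dist_eq_norm] at hT'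
    have := mul_lt_mul_of_pos_right hT' hxpos
    linarith

omit [FiniteDimensional ℝ F] in
theorem isClosed_setOf_not_injective_on (V : Submodule ℝ E) :
    IsClosed {T : E →L[ℝ] F | ¬ Function.Injective (T.comp V.subtypeL)} := by
  have : Continuous fun T : E →L[ℝ] F => T.comp V.subtypeL := by fun_prop
  exact (ContinuousLinearMap.isOpen_injective.preimage this).isClosed_compl

/-- Continuous linear maps near a surjective one are uniformly open. -/
theorem ContinuousLinearMap.eventually_closedBall_subset_image {W : Type*} [NormedAddCommGroup W]
    [NormedSpace ℝ W] [CompleteSpace W] {T : W →L[ℝ] F} (hT : Function.Surjective T) :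
    ∃ κ : ℝ, 0 < κ ∧ ∀ᶠ T' : W →L[ℝ] F in 𝓝 T, ∀ p : W, ∀ ε : ℝ, 0 ≤ ε →
      closedBall (T' p) (κ * ε) ⊆ T' '' closedBall p ε := by
  have hr : T.range = ⊤ := LinearMap.range_eq_top.2 hT
  set R := T.nonlinearRightInverseOfSurjective hr
  have hR : 0 < R.nnnorm := T.nonlinearRightInverseOfSurjective_nnnorm_pos hr
  refine ⟨(R.nnnorm : ℝ)⁻¹ / 2, by positivity, ?_⟩
  have : ∀ᶠ T' : W →L[ℝ] F in 𝓝 T, ‖T' - T‖₊ < R.nnnorm⁻¹ / 2 := eventually_nnnorm_sub_lt _ (by positivity)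
  filter_upwards [this] with T' hT' p ε hε
  have happ : ApproximatesLinearOn T' T univ (R.nnnorm⁻¹ / 2) := by
    intro x _ y _
    rw [← map_sub, ← sub_apply]
    refine ((T' - T).le_opNorm _).trans ?_
    gcongr
    exact_mod_cast hT'.le
  have := happ.surjOn_closedBall_of_nonlinearRightInverse R hε (subset_univ (closedBall p ε))
  have hhalf : (R.nnnorm : ℝ)⁻¹ - ((R.nnnorm⁻¹ / 2 : NNReal) : ℝ) = (R.nnnorm : ℝ)⁻¹ / 2 := by
    push_cast
    ring
  rwa [hhalf] at this

variable (C : ConvexCone ℝ E)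

/-- A convex cone has nonempty interior in its linear span. -/
theorem ConvexCone.interior_comap_span_nonempty (hC : (0 : E) ∈ C) :
    (interior (C.comap (Submodule.span ℝ (C : Set E)).subtype :
      Set (Submodule.span ℝ (C : Set E)))).Nonempty := by
  have hzero : (0 : Submodule.span ℝ (C : Set E)) ∈
      (C.comap (Submodule.span ℝ (C : Set E)).subtype : Set (Submodule.span ℝ (C : Set E))) := hC
  rw [(ConvexCone.convex _).interior_nonempty_iff_affineSpan_eq_top,
    AffineSubspace.affineSpan_eq_top_iff_vectorSpan_eq_top_of_nonempty _ _ _ ⟨0, hzero⟩,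
    vectorSpan_eq_span_vsub_set_right ℝ hzero]
  simp

/-- The maps that are surjective on `W` and whose kernel touches a cone without entering its
interior relative to `W` form a porous set. -/
theorem isPorous_setOf_ker_tangent {W : Submodule ℝ E} (hW : (C : Set E) ⊆ W)
    (hint : (interior (C.comap W.subtype : Set W)).Nonempty) :
    IsPorous {T : E →L[ℝ] F | Function.Surjective (T.comp W.subtypeL) ∧
      (∃ v ∈ C, v ≠ 0 ∧ T v = 0) ∧ ∀ u ∈ interior (C.comap W.subtype : Set W), T u ≠ 0} := by
  rintro T ⟨hsurj, ⟨v, hvC, hv0, hTv⟩, hTu⟩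
  obtain ⟨κ, hκ, hev⟩ := ContinuousLinearMap.eventually_closedBall_subset_image hsurj
  have hcont : Continuous fun T : E →L[ℝ] F => T.comp W.subtypeL := by fun_prop
  obtain ⟨η, hη, hopen⟩ := Metric.eventually_nhds_iff.1 (hcont.continuousAt.eventually hev)
  obtain ⟨φ, hφ⟩ := SeparatingDual.exists_eq_one (R := ℝ) hv0
  obtain ⟨u, hu⟩ := hint
  obtain ⟨ρ, hρ, hball⟩ := Metric.isOpen_iff.1 isOpen_interior u hu
  set Lu : E →L[ℝ] F := φ.smulRight (T u)
  set b : ℝ := 2 * ‖v‖ + ‖u‖ + 1 with hb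
  have hb0 : 0 < b := by positivity
  set c : ℝ := κ * ρ / (2 * b) with hc
  have hc0 : 0 < c := by positivity
  have hT : T ∈ {T : E →L[ℝ] F | Function.Surjective (T.comp W.subtypeL) ∧
      (∃ v ∈ C, v ≠ 0 ∧ T v = 0) ∧ ∀ u ∈ interior (C.comap W.subtype : Set W), T u ≠ 0} :=
    ⟨hsurj, ⟨v, hvC, hv0, hTv⟩, hTu⟩
  refine porosityAt_pos hT hc0 (norm_nonneg Lu)
    (ε₀ := min 1 (min (1 / (|φ u| + 1)) (η / (c + ‖Lu‖)))) (by positivity)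
    fun ε hε hε1 => ⟨T - ε • Lu, ?_, ?_⟩
  · rw [dist_eq_norm, sub_sub_cancel_left, norm_neg, norm_smul, Real.norm_of_nonneg hε.le, mul_comm]
  rw [Set.disjoint_left]
  rintro T' hT' ⟨-, -, hT'u⟩
  rw [lt_min_iff, lt_min_iff, lt_div_iff₀ (by positivity), lt_div_iff₀ (by positivity)] at hε1
  obtain ⟨hε1, hεφ, hεη⟩ := hε1
  have hφu : |ε * φ u| < 1 := by
    rw [abs_mul, abs_of_pos hε]
    linarith
  have hφu' := abs_lt.1 hφu
  have hdist : dist T' (T - ε • Lu) < c * ε := hT'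
  have hdT : dist T' T < η := by
    have h1 := dist_triangle T' (T - ε • Lu) T
    have h2 : dist (T - ε • Lu) T = ε * ‖Lu‖ := by
      rw [dist_eq_norm, sub_sub_cancel_left, norm_neg, norm_smul, Real.norm_of_nonneg hε.le]
    linarith
  let v' : W := ⟨v, hW hvC⟩
  let p : W := (1 - ε * φ u) • v' + ε • u
  have hp : (p : E) = (1 - ε * φ u) • v + ε • (u : E) := rfl
  have hnp : ‖p‖ ≤ b := by
    have h1 : ‖p‖ ≤ ‖(1 - ε * φ u) • v'‖ + ‖ε • u‖ := norm_add_le _ _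
    rw [norm_smul, norm_smul, Real.norm_of_nonneg hε.le, Real.norm_of_nonneg (by linarith)] at h1
    have h2 : (1 - ε * φ u) * ‖v'‖ ≤ 2 * ‖v‖ :=
      mul_le_mul_of_nonneg_right (by linarith) (norm_nonneg v)
    have h3 : ε * ‖u‖ ≤ 1 * ‖u‖ := by gcongr
    linarith
  have hzero : (T - ε • Lu) p = 0 := by
    have hφp : φ p = 1 := by rw [hp]; simp [hφ]
    have hTp : T p = ε • T u := by rw [hp]; simp [hTv]
    simp [Lu, hφp, hTp]
  have hT'p : ‖T' p‖ ≤ κ * (ε * ρ / 2) := by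
    have h1 : ‖(T' - (T - ε • Lu)) p‖ ≤ ‖T' - (T - ε • Lu)‖ * ‖p‖ :=
      (T' - (T - ε • Lu)).le_opNorm (p : E)
    rw [sub_apply, hzero, sub_zero, ← dist_eq_norm] at h1
    have h2 : dist T' (T - ε • Lu) * ‖p‖ ≤ c * ε * b := by gcongr
    have h3 : c * ε * b = κ * (ε * ρ / 2) := by rw [hc]; field_simp
    linarith
  obtain ⟨q, hq, hT'q⟩ := hopen hdT p (ε * ρ / 2) (by positivity)
    (show (0 : F) ∈ closedBall _ _ by simpa [mem_closedBall, dist_eq_norm] using hT'p)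
  refine hT'u q ?_ hT'q
  have hsub : ball p (ε * ρ) ⊆ (C.comap W.subtype : Set W) := by
    intro z hz
    have hzu : u + ε⁻¹ • (z - p) ∈ ball u ρ := by
      rw [mem_ball, dist_eq_norm] at hz ⊢
      rw [add_sub_cancel_left, norm_smul, norm_inv, Real.norm_of_nonneg hε.le,
        inv_mul_lt_iff₀ hε]
      exact hz
    have hmem : u + ε⁻¹ • (z - p) ∈ C.comap W.subtype := interior_subset (hball hzu)
    have hvmem : v' ∈ C.comap W.subtype := hvC
    have hz' : z = (1 - ε * φ u) • v' + ε • (u + ε⁻¹ • (z - p)) := by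
      rw [smul_add, smul_inv_smul₀ hε.ne']
      simp only [p]
      module
    rw [hz']
    exact add_mem (ConvexCone.smul_mem _ (by linarith) hvmem) (ConvexCone.smul_mem _ hε hmem)
  refine interior_maximal hsub isOpen_ball (closedBall_subset_ball ?_ hq)
  have := mul_pos hε hρ
  linarith

omit [FiniteDimensional ℝ F] in
theorem isOpen_setOf_ker_inter_cone_trivial (hC : IsClosed (C : Set E)) :
    IsOpen {T : E →L[ℝ] F | ∀ v ∈ C, v ≠ 0 → T v ≠ 0} := by
  rw [isOpen_iff_eventually]
  intro T hT
  have hcomp : IsCompact ((C : Set E) ∩ sphere 0 1) := (isCompact_sphere 0 1).inter_left hC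
  have hev : ∀ᶠ T' : E →L[ℝ] F in 𝓝 T, ∀ v ∈ (C : Set E) ∩ sphere 0 1, T' v ≠ 0 := by
    refine hcomp.eventually_forall_of_forall_eventually fun v hv => ?_
    have hcont : Continuous fun z : (E →L[ℝ] F) × E => z.1 z.2 := by fun_prop
    exact hcont.continuousAt.eventually_ne (hT v hv.1 (ne_of_mem_sphere hv.2 one_ne_zero))
  filter_upwards [hev] with T' hT' v hv hv0 hTv
  refine hT' (‖v‖⁻¹ • v) ⟨C.smul_mem (by positivity) hv, ?_⟩ (by rw [map_smul, hTv, smul_zero])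
  rw [mem_sphere_zero_iff_norm, norm_smul, norm_inv, norm_norm,
    inv_mul_cancel₀ (norm_ne_zero_iff.2 hv0)]

omit [FiniteDimensional ℝ F] in
theorem isClosed_image_of_ker_inter_asymptoticCone_trivial {X : Set E} (hX : IsClosed X)
    (hconv : Convex ℝ X) {T : E →L[ℝ] F} (hT : ∀ v ∈ asymptoticCone ℝ X, v ≠ 0 → T v ≠ 0) :
    IsClosed (T '' X) := by
  rw [← closure_subset_iff_isClosed]
  intro y hy
  set Y : Set E := X ∩ T ⁻¹' closedBall y 1 with hY
  have hYclosed : IsClosed Y := hX.inter (isClosed_closedBall.preimage T.continuous)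
  have hYconv : Convex ℝ Y :=
    hconv.inter ((convex_closedBall y 1).linear_preimage T.toLinearMap)
  have hbdd : Bornology.IsBounded Y := by
    rw [isBounded_iff_asymptoticCone_subset_singleton]
    intro v hv
    by_contra hv0
    have hTv := hT v (asymptoticCone_mono inter_subset_left hv) hv0
    obtain ⟨p, hp⟩ := asymptoticCone_nonempty.1 ⟨v, hv⟩
    have hbound : ∀ c : ℝ, 0 ≤ c → c * ‖T v‖ ≤ 2 := by
      intro c hc
      have h1 := (hYconv.smul_vadd_mem_of_isClosed_of_mem_asymptoticCone hYclosed hc hv hp).2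
      have h2 := hp.2
      rw [mem_preimage, mem_closedBall] at h1 h2
      have h3 := dist_triangle_right (T (c • v +ᵥ p)) (T p) y
      rw [dist_eq_norm, vadd_eq_add, map_add, add_sub_cancel_right, map_smul, norm_smul,
        Real.norm_of_nonneg hc] at h3
      rw [vadd_eq_add, map_add, map_smul] at h1
      linarith
    have := hbound (3 / ‖T v‖) (by positivity)
    rw [div_mul_cancel₀ _ (norm_ne_zero_iff.2 hTv)] at this
    linarith
  have hcomp : IsCompact (T '' Y) :=
    (Metric.isCompact_of_isClosed_isBounded hYclosed hbdd).image T.continuous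
  have hyY : y ∈ closure (T '' Y) := by
    rw [hY, image_inter_preimage]
    rw [mem_closure_iff_nhds] at hy ⊢
    intro t ht
    rw [inter_comm (T '' X), ← inter_assoc]
    exact hy _ (inter_mem ht (closedBall_mem_nhds y one_pos))
  rw [hcomp.isClosed.closure_eq] at hyY
  exact image_mono inter_subset_left hyY

theorem eventually_image_cone_eq_univ {W : Submodule ℝ E} {T : E →L[ℝ] F}
    (hsurj : Function.Surjective (T.comp W.subtypeL)) {u : W}
    (hu : u ∈ interior (C.comap W.subtype : Set W)) (hTu : T u = 0) :
    ∀ᶠ T' : E →L[ℝ] F in 𝓝 T, T' '' (C : Set E) = univ := by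
  obtain ⟨κ, hκ, hev⟩ := ContinuousLinearMap.eventually_closedBall_subset_image hsurj
  have hcont : Continuous fun T : E →L[ℝ] F => T.comp W.subtypeL := by fun_prop
  obtain ⟨ρ, hρ, hball⟩ := Metric.nhds_basis_closedBall.mem_iff.1 (mem_interior_iff_mem_nhds.1 hu)
  have hsmall : ∀ᶠ T' : E →L[ℝ] F in 𝓝 T, ‖T' u‖ < κ * ρ / 2 := by
    have : Continuous fun T' : E →L[ℝ] F => ‖T' u‖ := by fun_prop
    refine this.continuousAt.eventually_lt_const ?_
    simp only [hTu, norm_zero]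
    positivity
  filter_upwards [hcont.continuousAt.eventually hev, hsmall] with T' hT' hT'u
  refine eq_univ_of_forall fun y => ?_
  set t : ℝ := κ * ρ / 2 / (‖y‖ + 1) with ht
  have ht0 : 0 < t := by positivity
  have hty : t * ‖y‖ ≤ κ * ρ / 2 := by
    rw [ht, div_mul_eq_mul_div, div_le_iff₀ (by positivity)]
    gcongr
    linarith
  have hmem : t • y ∈ closedBall ((T'.comp W.subtypeL) u) (κ * ρ) := by
    rw [mem_closedBall, dist_eq_norm]
    have := norm_sub_le (t • y) ((T'.comp W.subtypeL) u)
    rw [norm_smul, Real.norm_of_nonneg ht0.le] at this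
    have h2 : ‖(T'.comp W.subtypeL) u‖ < κ * ρ / 2 := hT'u
    linarith
  obtain ⟨q, hq, hTq⟩ := hT' u ρ hρ.le hmem
  have hqC : (q : E) ∈ C := hball hq
  have hTq' : T' q = t • y := hTq
  exact ⟨t⁻¹ • (q : E), C.smul_mem (by positivity) hqC,
    by rw [map_smul, hTq', inv_smul_smul₀ ht0.ne']⟩

omit [FiniteDimensional ℝ E] in
theorem Submodule.exists_le_finrank_le (W : Submodule ℝ E) (d : ℕ) :
    ∃ V ≤ W, Module.finrank ℝ V ≤ d ∧ (V = W ∨ Module.finrank ℝ V = d) := by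
  rcases le_total (Module.finrank ℝ W) d with h | h
  · exact ⟨W, le_rfl, h, Or.inl rfl⟩
  · obtain ⟨f, hf⟩ := exists_linearIndependent_of_le_finrank h
    have hf' : LinearIndependent ℝ (fun i => (f i : E)) :=
      hf.map' W.subtype W.ker_subtype
    have hV : Module.finrank ℝ (Submodule.span ℝ (Set.range fun i => (f i : E))) = d := by
      rw [finrank_span_eq_card hf', Fintype.card_fin]
    refine ⟨_, Submodule.span_le.2 ?_, hV.le, Or.inr hV⟩
    rintro _ ⟨i, rfl⟩
    exact (f i).2

/-- The asymptotic cone of a convex set, as a convex cone. -/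
def Convex.asymptoticConvexCone {X : Set E} (hconv : Convex ℝ X) : ConvexCone ℝ E where
  carrier := asymptoticCone ℝ X
  smul_mem' _ hc _ hv := smul_mem_asymptoticCone hc.le hv
  add_mem' v hv w hw := by
    have h := hconv.asymptoticCone hv hw (a := 1 / 2) (b := 1 / 2) (by norm_num) (by norm_num)
      (by norm_num)
    have h2 := smul_mem_asymptoticCone (zero_le_two (α := ℝ)) h
    rwa [smul_add, smul_smul, smul_smul, mul_one_div_cancel two_ne_zero, one_smul, one_smul] at h2

/-- The maps around which closedness of the image of `X` may fail are covered by a closed porous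
set and a porous set. -/
theorem exists_porous_cover {X : Set E} (hX : IsClosed X) (hconv : Convex ℝ X)
    (hne : X.Nonempty) :
    ∃ N S : Set (E →L[ℝ] F), IsClosed N ∧ IsPorous N ∧ IsPorous S ∧
      (interior {T : E →L[ℝ] F | IsClosed (T '' X)})ᶜ ⊆ N ∪ S := by
  set C := hconv.asymptoticConvexCone
  have hC : (0 : E) ∈ C := zero_mem_asymptoticCone.2 hne
  set W := Submodule.span ℝ (C : Set E)
  obtain ⟨V, hVW, hVd, hV⟩ := W.exists_le_finrank_le (Module.finrank ℝ F)
  refine ⟨_, _, isClosed_setOf_not_injective_on V, isPorous_setOf_not_injective_on hVd,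
    isPorous_setOf_ker_tangent C Submodule.subset_span (C.interior_comap_span_nonempty hC), ?_⟩
  intro T hT
  by_cases hTV : Function.Injective (T.comp V.subtypeL)
  swap
  · exact Or.inl hTV
  have hker : ∃ v ∈ C, v ≠ 0 ∧ T v = 0 := by
    by_contra! hker
    refine hT (interior_maximal ?_ (isOpen_setOf_ker_inter_cone_trivial C
      isClosed_asymptoticCone) hker)
    exact fun T' hT' => isClosed_image_of_ker_inter_asymptoticCone_trivial hX hconv hT'
  have hsurj : Function.Surjective (T.comp W.subtypeL) := by
    rcases hV with hV | hV
    · obtain ⟨v, hvC, hv0, hTv⟩ := hker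
      have h0 : (⟨v, hV ▸ Submodule.subset_span hvC⟩ : V) = 0 := by
        apply hTV
        rw [map_zero]
        exact hTv
      exact absurd (congrArg Subtype.val h0) hv0
    · have hs := (LinearMap.injective_iff_surjective_of_finrank_eq_finrank
        (f := (T.comp V.subtypeL).toLinearMap) hV).1 hTV
      intro y
      obtain ⟨x, hx⟩ := hs y
      exact ⟨⟨x, hVW x.2⟩, hx⟩
  refine Or.inr ⟨hsurj, hker, fun u hu hTu => hT ?_⟩
  rw [mem_interior_iff_mem_nhds]
  filter_upwards [eventually_image_cone_eq_univ C hsurj hu hTu] with T' hT'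
  obtain ⟨p, hp⟩ := hne
  have : T' '' X = univ := by
    refine eq_univ_of_forall fun y => ?_
    obtain ⟨v, hv, hTv⟩ : y - T' p ∈ T' '' (C : Set E) := hT' ▸ mem_univ _
    refine ⟨(1 : ℝ) • v +ᵥ p,
      hconv.smul_vadd_mem_of_isClosed_of_mem_asymptoticCone hX zero_le_one hv hp, ?_⟩
    rw [vadd_eq_add, map_add, one_smul, hTv, sub_add_cancel]
  rw [this]
  exact isClosed_univ

end LinearMaps

/-- Main theorem: for a closed convex set X ⊆ ℝⁿ, the complement of the interior of the set of
linear maps T with T(X) closed is σ-porous in L(ℝⁿ,ℝᵐ); in particular that interior is dense. -/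
theorem main_sigmaPorous {n m : ℕ} (X : Set (EuclideanSpace ℝ (Fin n)))
    (hX : IsClosed X) (hconv : Convex ℝ X) :
    IsSigmaPorous
      ((Set.univ : Set (EuclideanSpace ℝ (Fin n) →L[ℝ] EuclideanSpace ℝ (Fin m))) \ interior
        {T : EuclideanSpace ℝ (Fin n) →L[ℝ] EuclideanSpace ℝ (Fin m) | IsClosed (T '' X)}) ∧
      Dense (interior {T : EuclideanSpace ℝ (Fin n) →L[ℝ] EuclideanSpace ℝ (Fin m) | IsClosed (T '' X)}) := by
  obtain ⟨N, S, hNclosed, hN, hS, hcover⟩ :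
      ∃ N S : Set (EuclideanSpace ℝ (Fin n) →L[ℝ] EuclideanSpace ℝ (Fin m)),
        IsClosed N ∧ IsPorous N ∧ IsPorous S ∧
          (interior {T : EuclideanSpace ℝ (Fin n) →L[ℝ] EuclideanSpace ℝ (Fin m) |
            IsClosed (T '' X)})ᶜ ⊆ N ∪ S := by
    rcases X.eq_empty_or_nonempty with rfl | hne
    · exact ⟨∅, ∅, isClosed_empty, fun _ h => h.elim, fun _ h => h.elim, by simp⟩
    · exact exists_porous_cover hX hconv hne
  refine ⟨hN.isSigmaPorous_of_subset_union hS (by rwa [← compl_eq_univ_sdiff]), ?_⟩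
  rw [← compl_compl (interior _), ← interior_eq_empty_iff_dense_compl, ← subset_empty_iff,
    ← hN.interior_eq_empty,
    ← interior_union_isClosed_of_interior_empty hNclosed hS.interior_eq_empty]
  exact interior_mono hcover
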